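/- Let N be an arithmetically decidable coded L-structure, let A ⊆ N be arithmetical, and let (a_n)_{n∈ℕ} be a sequence in N whose graph {(n, a_n) : n ∈ ℕ} is arithmetical, such that for every n, a_n does not belong to the substructure of N generated by A ∪ {a_i : i ≠ n}. For S ⊆ ℕ, let H_S be the domain of the substructure of N generated by A ∪ {a_n : n ∈ S}. Then H_S ≤_ar S, and for every n, a_n ∈ H_S if and only if n ∈ S. Consequently, if S has nonzero arithmetic degree D, then deg_ar(H_S) = D. -/

import Mathlib

open FirstOrder FirstOrder.Language

namespace ArMorley

/-! ## Arithmetical sets and arithmetic reducibility -/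

/-- Function symbols of the language of arithmetic: `0`, `1`, `+`, `·`. -/
inductive ArFunc : ℕ → Type
  | zero : ArFunc 0
  | one : ArFunc 0
  | add : ArFunc 2
  | mul : ArFunc 2

/-- Relation symbols: `<` and a unary oracle predicate. -/
inductive ArRel : ℕ → Type
  | lt : ArRel 2
  | mem : ArRel 1

/-- The language `(+, ·, 0, 1, <, Y)` of arithmetic with a unary oracle predicate. -/
def arithLang : FirstOrder.Language := ⟨ArFunc, ArRel⟩

/-- The standard structure on `ℕ`, with the oracle predicate interpreted by `Y`. -/
def arithStructure (Y : Set ℕ) : arithLang.Structure ℕ where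
  funMap := fun {n} f =>
    match f with
    | ArFunc.zero => fun _ => 0
    | ArFunc.one => fun _ => 1
    | ArFunc.add => fun v => v 0 + v 1
    | ArFunc.mul => fun v => v 0 * v 1
  RelMap := fun {n} r =>
    match r with
    | ArRel.lt => fun v => v 0 < v 1
    | ArRel.mem => fun v => v 0 ∈ Y

/-- `X ≤_ar Y` : `X` is definable without parameters in `(ℕ, +, ·, 0, 1, <, Y)`. -/
def ArReducible (X Y : Set ℕ) : Prop :=
  letI := arithStructure Y
  ∃ φ : arithLang.Formula (Fin 1), X = { n : ℕ | φ.Realize (fun _ => n) }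

/-- `X` is arithmetical: definable without parameters in `(ℕ, +, ·, 0, 1, <)`. -/
def IsArithmetical (X : Set ℕ) : Prop := ArReducible X ∅

/-- `X` and `Y` have the same arithmetic degree. -/
def ArEquiv (X Y : Set ℕ) : Prop := ArReducible X Y ∧ ArReducible Y X

/-! ## Coding conventions -/

/-- Code of a list of naturals. -/
def listCode (l : List ℕ) : ℕ := Encodable.encode l

/-- Code of a finite tuple of naturals. -/
def tupleCode {n : ℕ} (v : Fin n → ℕ) : ℕ := listCode (List.ofFn v)

/-- The subset of `ℕ` corresponding to a set of elements of a coded domain. -/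
def subCode {A : Set ℕ} (S : Set ↥A) : Set ℕ := Subtype.val '' S

/-- Code of a set of `n`-tuples from a coded domain as a subset of `ℕ`. -/
def tupleSetCode {A : Set ℕ} {n : ℕ} (X : Set (Fin n → ↥A)) : Set ℕ :=
  { c : ℕ | ∃ v ∈ X, c = tupleCode (fun i => ((v i : ℕ))) }

/-- Code of the graph of a function between coded domains. -/
def graphCode {A B : Set ℕ} (f : ↥A → ↥B) : Set ℕ :=
  { c : ℕ | ∃ a : ↥A, c = Nat.pair (a : ℕ) ((f a : ℕ)) }

/-! ## Gödel coded languages -/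

/-- A fixed Gödel coding of the symbols of a countable first-order language. -/
structure GoedelCoding (L : FirstOrder.Language) where
  encFun : ∀ n, L.Functions n → ℕ
  encFun_inj : ∀ n, Function.Injective (encFun n)
  encRel : ∀ n, L.Relations n → ℕ
  encRel_inj : ∀ n, Function.Injective (encRel n)

variable {L : FirstOrder.Language}

/-- The set of codes of the symbols of `L`. -/
def symbolCodes (g : GoedelCoding L) : Set ℕ :=
  { c | (∃ (n : ℕ) (f : L.Functions n), c = Nat.pair 0 (Nat.pair n (g.encFun n f))) ∨
        (∃ (n : ℕ) (R : L.Relations n), c = Nat.pair 1 (Nat.pair n (g.encRel n R))) }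

/-- `L` is an arithmetically definable language. -/
def ArithLang (g : GoedelCoding L) : Prop := IsArithmetical (symbolCodes g)

/-- Code of a term, with a given coding of the variables. -/
def termCode (g : GoedelCoding L) {α : Type} (encα : α → ℕ) (t : L.Term α) : ℕ :=
  listCode (t.listEncode.map (Sum.elim (fun a => Nat.pair 0 (encα a))
    (fun p => Nat.pair 1 (Nat.pair p.1 (g.encFun p.1 p.2)))))

/-- Code of a (bounded) formula, with a given coding of free variables. -/
def formulaCode (g : GoedelCoding L) {α : Type} (encα : α → ℕ) {n : ℕ}
    (φ : L.BoundedFormula α n) : ℕ :=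
  listCode (φ.listEncode.map (Sum.elim
    (fun p => Nat.pair 0 (Nat.pair p.1
      (termCode g (Sum.elim (fun a => Nat.pair 0 (encα a)) (fun i => Nat.pair 1 i.1)) p.2)))
    (Sum.elim
      (fun q => Nat.pair 1 (Nat.pair q.1 (g.encRel q.1 q.2)))
      (fun m => Nat.pair 2 m))))

/-- Code of a sentence. -/
def sentenceCode (g : GoedelCoding L) (φ : L.Sentence) : ℕ :=
  formulaCode g (fun a : Empty => a.elim) φ

/-- The set of codes of the axioms of a theory. -/
def theoryCode (g : GoedelCoding L) (T : L.Theory) : Set ℕ :=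
  { c | ∃ φ ∈ T, c = sentenceCode g φ }

/-- `T` is an arithmetically definable theory. -/
def ArithTheory (g : GoedelCoding L) (T : L.Theory) : Prop := IsArithmetical (theoryCode g T)

/-! ## Coded structures -/

/-- A coded `L`-structure: an `L`-structure whose domain is a subset of `ℕ`
with infinite complement. -/
structure CodedStructure (L : FirstOrder.Language) where
  carrier : Set ℕ
  compl_infinite : (carrierᶜ : Set ℕ).Infinite
  struc : L.Structure ↥carrier

/-- A coded structure is a model of `T`. -/
def CodedStructure.Models (M : CodedStructure L) (T : L.Theory) : Prop :=
  ∀ φ ∈ T, @Sentence.Realize L ↥M.carrier M.struc φ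

/-- The (coded) elementary diagram of a coded structure. -/
def elemDiagram (g : GoedelCoding L) (M : CodedStructure L) : Set ℕ :=
  { c | ∃ (k : ℕ) (φ : L.Formula (Fin k)) (a : Fin k → ↥M.carrier),
      c = Nat.pair (Nat.pair k (formulaCode g Fin.val φ)) (tupleCode fun i => ((a i : ℕ))) ∧
      (letI := M.struc; φ.Realize a) }

/-- A coded structure is arithmetically decidable if its elementary diagram is arithmetical. -/
def ArithDecidable (g : GoedelCoding L) (M : CodedStructure L) : Prop :=
  IsArithmetical (elemDiagram g M)

/-- `M ≼ N` for coded structures: `M`'s domain is contained in `N`'s, and the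
inclusion is elementary. -/
structure ElemSub (M N : CodedStructure L) : Prop where
  subset : M.carrier ⊆ N.carrier
  elem : ∀ (k : ℕ) (φ : L.Formula (Fin k)) (a : Fin k → ↥M.carrier),
    (letI := M.struc; φ.Realize a) ↔
      (letI := N.struc; φ.Realize (fun i => (⟨((a i : ℕ)), subset (a i).2⟩ : ↥N.carrier)))

/-- A coded model of `T` is arithmetically extendible if it is an elementary substructure of
an arithmetically decidable coded model of `T`. -/
def ArithExtendible (g : GoedelCoding L) (T : L.Theory) (M : CodedStructure L) : Prop :=
  ∃ N : CodedStructure L, ArithDecidable g N ∧ N.Models T ∧ ElemSub M N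

/-! ## Model-theoretic notions in arbitrary structures -/

/-- `N` (with structure `SN`) is a model of `T`. -/
def ModelsT (L : FirstOrder.Language) (T : L.Theory) (N : Type) (SN : L.Structure N) : Prop :=
  ∀ φ ∈ T, @Sentence.Realize L N SN φ

/-- `T` has no finite models. -/
def NoFiniteModels (L : FirstOrder.Language) (T : L.Theory) : Prop :=
  ∀ (N : Type) (SN : L.Structure N), ModelsT L T N SN → Infinite N

/-- Elementary embeddings, with the structures given explicitly. -/
def EEmb (L : FirstOrder.Language) (M : Type) (SM : L.Structure M)
    (N : Type) (SN : L.Structure N) : Type _ :=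
  @FirstOrder.Language.ElementaryEmbedding L M N SM SN

/-- The underlying map of an elementary embedding. -/
def EEmb.fn {L : FirstOrder.Language} {M : Type} {SM : L.Structure M}
    {N : Type} {SN : L.Structure N} (j : EEmb L M SM N SN) : M → N :=
  @FirstOrder.Language.ElementaryEmbedding.toFun L M N SM SN j

/-- A subset of `N^n` definable with parameters from `P`. -/
def DefinableOverT (L : FirstOrder.Language) (N : Type) (SN : L.Structure N) (P : Set N)
    {n : ℕ} (X : Set (Fin n → N)) : Prop :=
  letI := SN
  ∃ (m : ℕ) (ψ : L.Formula (Fin n ⊕ Fin m)) (b : Fin m → N),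
    (∀ i, b i ∈ P) ∧ X = { v | ψ.Realize (Sum.elim v b) }

/-- A subset of `N` definable with (arbitrary) parameters. -/
def Definable1 (L : FirstOrder.Language) (N : Type) (SN : L.Structure N) (Y : Set N) : Prop :=
  letI := SN
  ∃ (m : ℕ) (ψ : L.Formula (Fin 1 ⊕ Fin m)) (b : Fin m → N),
    Y = { x : N | ψ.Realize (Sum.elim (fun _ => x) b) }

/-- The algebraic closure of `B` in `N`: elements satisfying a formula with parameters
from `B` having finitely many solutions. -/
def aclIn (L : FirstOrder.Language) (N : Type) (SN : L.Structure N) (B : Set N) : Set N :=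
  letI := SN
  { a : N | ∃ (k : ℕ) (φ : L.Formula (Fin 1 ⊕ Fin k)) (b : Fin k → N),
      (∀ i, b i ∈ B) ∧ φ.Realize (Sum.elim (fun _ => a) b) ∧
      { x : N | φ.Realize (Sum.elim (fun _ => x) b) }.Finite }

/-- The domain of the substructure of `N` generated by `B`: values of terms at
arguments from `B`. -/
def genSub (L : FirstOrder.Language) (N : Type) (SN : L.Structure N) (B : Set N) : Set N :=
  letI := SN
  { a : N | ∃ (t : L.Term ℕ) (v : ℕ → N), (∀ i, v i ∈ B) ∧ a = t.realize v }

/-- The set defined by a formula `φ(x, p̄)` in one free variable with parameters `p̄`. -/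
def smSet (L : FirstOrder.Language) (N : Type) (SN : L.Structure N) {k : ℕ}
    (φ : L.Formula (Fin 1 ⊕ Fin k)) (p : Fin k → N) : Set N :=
  letI := SN
  { x : N | φ.Realize (Sum.elim (fun _ => x) p) }

/-- A definable tuple-set in a coded structure, with parameters from `P`. -/
def DefinableOver (M : CodedStructure L) (P : Set ↥M.carrier) {n : ℕ}
    (X : Set (Fin n → ↥M.carrier)) : Prop :=
  DefinableOverT L ↥M.carrier M.struc P X

/-- A definable tuple-set in a coded structure, with arbitrary parameters. -/
def DefinableIn (M : CodedStructure L) {n : ℕ} (X : Set (Fin n → ↥M.carrier)) : Prop :=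
  DefinableOver M Set.univ X

/-! ## Isomorphisms of coded structures and `D`-categoricity -/

/-- An isomorphism of coded `L`-structures. -/
structure CodedIso (M N : CodedStructure L) where
  toFun : ↥M.carrier → ↥N.carrier
  invFun : ↥N.carrier → ↥M.carrier
  left_inv : Function.LeftInverse invFun toFun
  right_inv : Function.RightInverse invFun toFun
  map_fun : ∀ {k : ℕ} (f : L.Functions k) (v : Fin k → ↥M.carrier),
    toFun (M.struc.funMap f v) = N.struc.funMap f (toFun ∘ v)
  map_rel : ∀ {k : ℕ} (r : L.Relations k) (v : Fin k → ↥M.carrier),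
    M.struc.RelMap r v ↔ N.struc.RelMap r (toFun ∘ v)

/-- `f` is a `D`-preserving isomorphism, where `d` is a representative of the
arithmetic degree `D`. -/
def DPreserving (d : Set ℕ) {M N : CodedStructure L} (f : CodedIso M N) : Prop :=
  ArReducible (graphCode f.toFun) d ∧
  ArReducible (graphCode f.invFun) d ∧
  (∀ (n : ℕ) (X : Set (Fin n → ↥M.carrier)), DefinableIn M X →
      ArEquiv (tupleSetCode X) d →
      ArEquiv (tupleSetCode ((fun v => f.toFun ∘ v) '' X)) d) ∧
  (∀ (n : ℕ) (Y : Set (Fin n → ↥N.carrier)), DefinableIn N Y →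
      ArEquiv (tupleSetCode Y) d →
      ArEquiv (tupleSetCode ((fun v => f.invFun ∘ v) '' Y)) d)

/-- `T` is `D`-categorical, where `d` is a representative of the nonzero
arithmetic degree `D`. -/
def DCategorical (g : GoedelCoding L) (T : L.Theory) (d : Set ℕ) : Prop :=
  ∀ M₀ M₁ M₂ : CodedStructure L,
    ArithDecidable g M₀ → M₀.Models T →
    M₁.Models T → ArithExtendible g T M₁ →
    M₂.Models T → ArithExtendible g T M₂ →
    ElemSub M₀ M₁ → ElemSub M₀ M₂ →
    ArEquiv M₁.carrier d → ArEquiv M₂.carrier d →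
    ∃ f : CodedIso M₁ M₂, DPreserving d f ∧
      ∀ (x : ℕ) (hx : x ∈ M₀.carrier) (h₁ : x ∈ M₁.carrier),
        ((f.toFun ⟨x, h₁⟩ : ℕ)) = x

/-! ## Vaughtian pairs, prime models, strong minimality -/

/-- `T` has a Vaughtian pair. -/
def HasVaughtianPair (T : L.Theory) : Prop :=
  ∃ (N : Type) (SN : L.Structure N),
    ModelsT L T N SN ∧
    ∃ S : @FirstOrder.Language.ElementarySubstructure L N SN,
      ((S.toSubstructure : Set N) ≠ Set.univ ∧
      ∃ (k : ℕ) (φ : L.Formula (Fin 1 ⊕ Fin k)) (a : Fin k → N),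
        (∀ i, a i ∈ (S.toSubstructure : Set N)) ∧
        smSet L N SN φ a ⊆ (S.toSubstructure : Set N) ∧
        (smSet L N SN φ a).Infinite)

/-- A coded model of `T` is prime: it elementarily embeds into every model of `T`. -/
def PrimeModel (L : FirstOrder.Language) (T : L.Theory) (P : CodedStructure L) : Prop :=
  P.Models T ∧ ∀ (N : Type) (SN : L.Structure N), ModelsT L T N SN →
    Nonempty (EEmb L ↥P.carrier P.struc N SN)

/-- `φ(x, p̄)` is strongly minimal over the coded model `M`: its solution set in `M` is
infinite, and in every elementary extension of `M` modelling `T` every definable subset of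
its solution set is finite or cofinite in it. -/
def StronglyMinimalOver (T : L.Theory) (M : CodedStructure L) {k : ℕ}
    (φ : L.Formula (Fin 1 ⊕ Fin k)) (p : Fin k → ↥M.carrier) : Prop :=
  (smSet L ↥M.carrier M.struc φ p).Infinite ∧
  ∀ (N : Type) (SN : L.Structure N), ModelsT L T N SN →
    ∀ j : EEmb L ↥M.carrier M.struc N SN,
      ∀ Y : Set N, Definable1 L N SN Y →
        Y ⊆ smSet L N SN φ (fun i => j.fn (p i)) →
        (Y.Finite ∨ ((smSet L N SN φ (fun i => j.fn (p i))) \ Y).Finite)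

/-- `T` is a strongly minimal theory: every model is infinite, and every
parameter-definable subset of any model is finite or cofinite. -/
def StronglyMinimalTheory (L : FirstOrder.Language) (T : L.Theory) : Prop :=
  (∀ (N : Type) (SN : L.Structure N), ModelsT L T N SN → Infinite N) ∧
  (∀ (N : Type) (SN : L.Structure N), ModelsT L T N SN →
    ∀ Y : Set N, Definable1 L N SN Y → (Y.Finite ∨ (Yᶜ : Set N).Finite))

/-- The structural control clause: an arithmetically decidable prime model together with
a strongly minimal formula over it generating every elementary extension. -/
def GeneratesAll (T : L.Theory) (P : CodedStructure L) {k : ℕ}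
    (φ : L.Formula (Fin 1 ⊕ Fin k)) (p : Fin k → ↥P.carrier) : Prop :=
  ∀ (N : Type) (SN : L.Structure N), ModelsT L T N SN →
    ∀ j : EEmb L ↥P.carrier P.struc N SN,
      aclIn L N SN (Set.range j.fn ∪ smSet L N SN φ (fun i => j.fn (p i))) = Set.univ

/-- Clause (3) of the arithmetic Baldwin–Lachlan theorem. -/
def SMControl (g : GoedelCoding L) (T : L.Theory) : Prop :=
  ∃ (P : CodedStructure L), ArithDecidable g P ∧ PrimeModel L T P ∧
    ∃ (k : ℕ) (φ : L.Formula (Fin 1 ⊕ Fin k)) (p : Fin k → ↥P.carrier),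
      StronglyMinimalOver T P φ p ∧ GeneratesAll T P φ p

/-! ## Types and arithmetical stability -/

/-- A formula with a finite parameter tuple from a coded structure, in `n` object
variables. -/
def ParamFormula (L : FirstOrder.Language) (M : CodedStructure L) (n : ℕ) : Type :=
  Σ k : ℕ, L.Formula (Fin n ⊕ Fin k) × (Fin k → ↥M.carrier)

/-- All parameters of `q` lie in `A`. -/
def paramsIn {M : CodedStructure L} {n : ℕ} (A : Set ℕ) (q : ParamFormula L M n) : Prop :=
  ∀ i, ((q.2.2 i : ℕ)) ∈ A

/-- `p` is consistent with the elementary diagram of `M`: it is realized in some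
elementary extension of `M`. -/
def TypeConsistent (M : CodedStructure L) {n : ℕ} (p : Set (ParamFormula L M n)) : Prop :=
  ∃ (N : Type) (SN : L.Structure N) (j : EEmb L ↥M.carrier M.struc N SN) (b : Fin n → N),
    ∀ q ∈ p, letI := SN; q.2.1.Realize (Sum.elim b (fun i => j.fn (q.2.2 i)))

/-- `p` is a (complete) `n`-type over `A` inside `M`: a maximal set of formulas with
parameters from `A` consistent with the elementary diagram of `M`. -/
def IsNType (M : CodedStructure L) (A : Set ℕ) (n : ℕ)
    (p : Set (ParamFormula L M n)) : Prop :=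
  (∀ q ∈ p, paramsIn A q) ∧
  TypeConsistent M p ∧
  ∀ q : ParamFormula L M n, paramsIn A q → q ∉ p → ¬ TypeConsistent M (insert q p)

/-- The code of a formula-with-parameters. -/
def pfCode (g : GoedelCoding L) {M : CodedStructure L} {n : ℕ} (q : ParamFormula L M n) : ℕ :=
  Nat.pair
    (Nat.pair q.1 (formulaCode g
      (Sum.elim (fun i : Fin n => Nat.pair 0 i.1) (fun j : Fin q.1 => Nat.pair 1 j.1)) q.2.1))
    (tupleCode fun i => ((q.2.2 i : ℕ)))

/-- The set of codes of the formulas of `p`. -/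
def typeCode (g : GoedelCoding L) {M : CodedStructure L} {n : ℕ}
    (p : Set (ParamFormula L M n)) : Set ℕ :=
  { c | ∃ q ∈ p, c = pfCode g q }

/-- `p` is realized in the coded elementary extension `N` of `M`. -/
def RealizesType {M N : CodedStructure L} (h : M.carrier ⊆ N.carrier) {n : ℕ}
    (p : Set (ParamFormula L M n)) : Prop :=
  ∃ b : Fin n → ↥N.carrier, ∀ q ∈ p,
    letI := N.struc
    q.2.1.Realize (Sum.elim b (fun i => (⟨((q.2.2 i : ℕ)), h (q.2.2 i).2⟩ : ↥N.carrier)))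

/-- The `(n, i)`-th column of an effective join. -/
def tripleSection (X : Set ℕ) (n i : ℕ) : Set ℕ := { m | Nat.pair n (Nat.pair i m) ∈ X }

/-- `T` is arithmetically stable: over every arithmetically decidable model and every
arithmetical parameter set, the family of arithmetic `n`-types (for all `n ≥ 1`) has a
uniform arithmetical code in which every arithmetic `n`-type appears at least once. -/
def ArithStable (g : GoedelCoding L) (T : L.Theory) : Prop :=
  ∀ M : CodedStructure L, ArithDecidable g M → M.Models T →
    ∀ A : Set ℕ, A ⊆ M.carrier → IsArithmetical A →
      ∃ X : Set ℕ, IsArithmetical X ∧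
        (∀ n, 1 ≤ n → ∀ i : ℕ, ∃ p : Set (ParamFormula L M n),
            IsNType M A n p ∧ IsArithmetical (typeCode g p) ∧
            tripleSection X n i = typeCode g p) ∧
        (∀ n, 1 ≤ n → ∀ p : Set (ParamFormula L M n),
            IsNType M A n p → IsArithmetical (typeCode g p) →
            ∃ i : ℕ, tripleSection X n i = typeCode g p)

/-- The set of elements occurring as a coordinate of a tuple in `X`. -/
def coordSet {N : Type} {n : ℕ} (X : Set (Fin n → N)) : Set N :=
  { m | ∃ v ∈ X, ∃ i, v i = m }


/-- The hull of `A ∪ {aₙ : n ∈ S}` in a coded structure: the domain of the generated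
substructure. -/
def hullS (L : FirstOrder.Language) (N : CodedStructure L) (A : Set ℕ)
    (a : ℕ → ↥N.carrier) (S : Set ℕ) : Set ↥N.carrier :=
  genSub L ↥N.carrier N.struc
    ({ x : ↥N.carrier | (x : ℕ) ∈ A } ∪ { x | ∃ n ∈ S, a n = x })

/-! ## Relations and functions definable from an oracle -/

section Definability

open Sum

/-- The relation `P` on tuples of naturals is definable without parameters in arithmetic with
oracle `Y`. -/
def ArDef (Y : Set ℕ) {α : Type} (P : (α → ℕ) → Prop) : Prop :=
  letI := arithStructure Y
  (∅ : Set ℕ).Definable arithLang {v : α → ℕ | P v}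

/-- The function `f` on tuples of naturals has a graph definable without parameters in arithmetic
with oracle `Y`. -/
def ArFun (Y : Set ℕ) {α : Type} (f : (α → ℕ) → ℕ) : Prop :=
  ArDef Y fun w : α ⊕ Fin 1 → ℕ => w (inr 0) = f fun i => w (inl i)

variable {Y : Set ℕ} {α β : Type}

theorem ArDef.of_iff {P Q : (α → ℕ) → Prop} (h : ArDef Y P) (hPQ : ∀ v, Q v ↔ P v) :
    ArDef Y Q := by
  rwa [funext fun v => propext (hPQ v)]

theorem arReducible_iff {X : Set ℕ} :
    ArReducible X Y ↔ ArDef Y fun v : Fin 1 → ℕ => v 0 ∈ X := by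
  let := arithStructure Y
  refine Iff.trans ?_ Set.empty_definable_iff.symm
  refine exists_congr fun φ => ⟨?_, ?_⟩
  · rintro rfl
    ext v
    have : v = fun _ => v 0 := funext fun i => congrArg v (Subsingleton.elim _ _)
    change φ.Realize (fun _ => v 0) ↔ φ.Realize v
    rw [← this]
  · intro h
    ext n
    exact Set.ext_iff.1 h fun _ => n

theorem ArDef.and {P Q : (α → ℕ) → Prop} (hP : ArDef Y P) (hQ : ArDef Y Q) :
    ArDef Y fun v => P v ∧ Q v :=
  letI := arithStructure Y
  Set.Definable.inter hP hQ

theorem ArDef.or {P Q : (α → ℕ) → Prop} (hP : ArDef Y P) (hQ : ArDef Y Q) :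
    ArDef Y fun v => P v ∨ Q v :=
  letI := arithStructure Y
  Set.Definable.union hP hQ

theorem ArDef.not {P : (α → ℕ) → Prop} (hP : ArDef Y P) : ArDef Y fun v => ¬ P v :=
  letI := arithStructure Y
  Set.Definable.compl hP

theorem ArDef.imp {P Q : (α → ℕ) → Prop} (hP : ArDef Y P) (hQ : ArDef Y Q) :
    ArDef Y fun v => P v → Q v :=
  (hP.not.or hQ).of_iff fun _ => imp_iff_not_or

theorem ArDef.const (p : Prop) : ArDef Y fun _ : α → ℕ => p := by
  let := arithStructure Y
  by_cases hp : p
  · simp [ArDef, hp]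
  · simp [ArDef, hp]

theorem ArDef.reindex {P : (α → ℕ) → Prop} (hP : ArDef Y P) (e : α → β) :
    ArDef Y fun w : β → ℕ => P fun i => w (e i) :=
  letI := arithStructure Y
  Set.Definable.preimage_comp e hP

theorem ArDef.ex_fun [Finite β] {P : (α → ℕ) → (β → ℕ) → Prop}
    (h : ArDef Y fun w : α ⊕ β → ℕ => P (fun i => w (inl i)) fun j => w (inr j)) :
    ArDef Y fun v => ∃ u, P v u :=
  letI := arithStructure Y
  Set.Definable.exists_of_finite h

theorem ArDef.ex {P : (α → ℕ) → ℕ → Prop}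
    (h : ArDef Y fun w : α ⊕ Fin 1 → ℕ => P (fun i => w (inl i)) (w (inr 0))) :
    ArDef Y fun v => ∃ y, P v y :=
  (ArDef.ex_fun (P := fun v (u : Fin 1 → ℕ) => P v (u 0)) h).of_iff fun _ =>
    ⟨fun ⟨y, hy⟩ => ⟨fun _ => y, hy⟩, fun ⟨u, hu⟩ => ⟨u 0, hu⟩⟩

theorem ArDef.all {P : (α → ℕ) → ℕ → Prop}
    (h : ArDef Y fun w : α ⊕ Fin 1 → ℕ => P (fun i => w (inl i)) (w (inr 0))) :
    ArDef Y fun v => ∀ y, P v y :=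
  (ArDef.ex (P := fun v y => ¬ P v y) h.not).not.of_iff fun _ => by simp

theorem ArDef.forall_finite [Finite β] {P : β → (α → ℕ) → Prop} (h : ∀ b, ArDef Y (P b)) :
    ArDef Y fun v => ∀ b, P b v := by
  let := arithStructure Y
  have := Set.definable_iInter_of_finite h
  rwa [← Set.ofPred_forall] at this

theorem ArFun.reindex {f : (α → ℕ) → ℕ} (hf : ArFun Y f) (e : α → β) :
    ArFun Y fun w : β → ℕ => f fun i => w (e i) :=
  ArDef.reindex (P := fun w : α ⊕ Fin 1 → ℕ => w (inr 0) = f fun i => w (inl i)) hf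
    (Sum.map e id)

theorem arDef_term_eq (t s : arithLang.Term α) :
    letI := arithStructure Y
    ArDef Y fun v => t.realize v = s.realize v :=
  letI := arithStructure Y
  Set.empty_definable_iff.2 ⟨t.equal s, by ext v; exact Formula.realize_equal.symm⟩

theorem ArFun.var (i : α) : ArFun Y fun v => v i :=
  arDef_term_eq (.var (inr 0)) (.var (inl i))

theorem ArDef.subst [Finite β] {P : (β → ℕ) → Prop} (hP : ArDef Y P) {f : β → (α → ℕ) → ℕ}
    (hf : ∀ b, ArFun Y (f b)) : ArDef Y fun v => P fun b => f b v := by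
  refine ArDef.of_iff (ArDef.ex_fun (P := fun v u => (∀ b, u b = f b v) ∧ P u)
    ((ArDef.forall_finite fun b => ?_).and (hP.reindex inr))) fun v => ?_
  · exact ArDef.reindex (P := fun w : α ⊕ Fin 1 → ℕ => w (inr 0) = f b fun i => w (inl i)) (hf b)
      (Sum.elim inl fun _ => inr b)
  · constructor
    · exact fun h => ⟨_, fun _ => rfl, h⟩
    · rintro ⟨u, hu, h⟩
      rwa [← funext hu]

theorem ArFun.comp [Finite β] {g : (β → ℕ) → ℕ} (hg : ArFun Y g) {f : β → (α → ℕ) → ℕ}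
    (hf : ∀ b, ArFun Y (f b)) : ArFun Y fun v => g fun b => f b v :=
  ArDef.subst (P := fun w : β ⊕ Fin 1 → ℕ => w (inr 0) = g fun i => w (inl i))
    (f := Sum.elim (fun b w => f b fun i => w (inl i)) fun _ w => w (inr 0)) hg
    (Sum.rec (fun b => (hf b).reindex inl) fun _ => ArFun.var _)

theorem ArDef.comp₁ {R : ℕ → Prop} (hR : ArDef Y fun v : Fin 1 → ℕ => R (v 0))
    {f : (α → ℕ) → ℕ} (hf : ArFun Y f) : ArDef Y fun v => R (f v) :=
  ArDef.subst (f := fun _ => f) hR fun _ => hf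

theorem ArDef.comp₂ {R : ℕ → ℕ → Prop} (hR : ArDef Y fun v : Fin 2 → ℕ => R (v 0) (v 1))
    {f g : (α → ℕ) → ℕ} (hf : ArFun Y f) (hg : ArFun Y g) : ArDef Y fun v => R (f v) (g v) :=
  ArDef.subst (f := ![f, g]) hR (Fin.forall_fin_two.2 ⟨hf, hg⟩)

theorem ArFun.comp₁ {h : ℕ → ℕ} (hh : ArFun Y fun v : Fin 1 → ℕ => h (v 0))
    {f : (α → ℕ) → ℕ} (hf : ArFun Y f) : ArFun Y fun v => h (f v) :=
  ArFun.comp (f := fun _ => f) hh fun _ => hf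

theorem ArFun.comp₂ {h : ℕ → ℕ → ℕ} (hh : ArFun Y fun v : Fin 2 → ℕ => h (v 0) (v 1))
    {f g : (α → ℕ) → ℕ} (hf : ArFun Y f) (hg : ArFun Y g) : ArFun Y fun v => h (f v) (g v) :=
  ArFun.comp (f := ![f, g]) hh (Fin.forall_fin_two.2 ⟨hf, hg⟩)

theorem ArDef.eq {f g : (α → ℕ) → ℕ} (hf : ArFun Y f) (hg : ArFun Y g) :
    ArDef Y fun v => f v = g v :=
  ArDef.comp₂ (R := (· = ·)) (arDef_term_eq (.var 0) (.var 1)) hf hg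

theorem ArDef.lt {f g : (α → ℕ) → ℕ} (hf : ArFun Y f) (hg : ArFun Y g) :
    ArDef Y fun v => f v < g v := by
  refine ArDef.comp₂ (R := (· < ·)) ?_ hf hg
  let := arithStructure Y
  refine Set.empty_definable_iff.2
    ⟨Relations.formula₂ (L := arithLang) ArRel.lt (.var 0) (.var 1), ?_⟩
  ext v
  exact (Formula.realize_rel₂ (L := arithLang) (M := ℕ) (R := ArRel.lt) (v := v) (t₁ := .var 0)
    (t₂ := .var 1)).symm

theorem ArDef.oracle {f : (α → ℕ) → ℕ} (hf : ArFun Y f) : ArDef Y fun v => f v ∈ Y := by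
  refine ArDef.comp₁ (R := (· ∈ Y)) ?_ hf
  let := arithStructure Y
  refine Set.empty_definable_iff.2 ⟨Relations.formula₁ (L := arithLang) ArRel.mem (.var 0), ?_⟩
  ext v
  exact (Formula.realize_rel₁ (L := arithLang) (M := ℕ) (R := ArRel.mem) (v := v)
    (t := .var 0)).symm

theorem ArFun.add {f g : (α → ℕ) → ℕ} (hf : ArFun Y f) (hg : ArFun Y g) :
    ArFun Y fun v => f v + g v :=
  ArFun.comp₂ (h := (· + ·)) (arDef_term_eq (.var (inr 0))
    (Functions.apply₂ (L := arithLang) ArFunc.add (.var (inl 0)) (.var (inl 1)))) hf hg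

theorem ArFun.mul {f g : (α → ℕ) → ℕ} (hf : ArFun Y f) (hg : ArFun Y g) :
    ArFun Y fun v => f v * g v :=
  ArFun.comp₂ (h := (· * ·)) (arDef_term_eq (.var (inr 0))
    (Functions.apply₂ (L := arithLang) ArFunc.mul (.var (inl 0)) (.var (inl 1)))) hf hg

theorem ArFun.const (n : ℕ) : ArFun Y fun _ : α → ℕ => n := by
  induction n with
  | zero => exact arDef_term_eq (.var (inr 0)) (Constants.term (L := arithLang) ArFunc.zero)
  | succ n ih =>
    exact ih.add (arDef_term_eq (.var (inr 0)) (Constants.term (L := arithLang) ArFunc.one))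

theorem ArFun.pair {f g : (α → ℕ) → ℕ} (hf : ArFun Y f) (hg : ArFun Y g) :
    ArFun Y fun v => Nat.pair (f v) (g v) := by
  refine ArFun.comp₂ (h := Nat.pair) ?_ hf hg
  have a : ArFun Y fun w : Fin 2 ⊕ Fin 1 → ℕ => w (inl 0) := .var _
  have b : ArFun Y fun w : Fin 2 ⊕ Fin 1 → ℕ => w (inl 1) := .var _
  have c : ArFun Y fun w : Fin 2 ⊕ Fin 1 → ℕ => w (inr 0) := .var _
  refine ArDef.of_iff (((ArDef.lt a b).and (ArDef.eq c ((b.mul b).add a))).or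
    ((ArDef.lt a b).not.and (ArDef.eq c (((a.mul a).add a).add b)))) fun w => ?_
  change w (inr 0) = Nat.pair (w (inl 0)) (w (inl 1)) ↔ _
  rw [Nat.pair]
  split_ifs with h <;> simp [h]

theorem ArFun.unpair_fst {f : (α → ℕ) → ℕ} (hf : ArFun Y f) :
    ArFun Y fun v => (f v).unpair.1 := by
  refine ArFun.comp₁ (h := fun n => n.unpair.1) ?_ hf
  refine ArDef.of_iff (ArDef.ex (P := fun w z => w (inl 0) = Nat.pair (w (inr 0)) z)
    (ArDef.eq (.var _) (.pair (.var _) (.var _)))) fun w => ?_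
  constructor
  · intro h
    exact ⟨(w (inl 0)).unpair.2, by rw [h, Nat.pair_unpair]⟩
  · rintro ⟨z, hz⟩
    change _ = (w (inl 0)).unpair.1
    rw [hz, Nat.unpair_pair]

theorem ArFun.unpair_snd {f : (α → ℕ) → ℕ} (hf : ArFun Y f) :
    ArFun Y fun v => (f v).unpair.2 := by
  refine ArFun.comp₁ (h := fun n => n.unpair.2) ?_ hf
  refine ArDef.of_iff (ArDef.ex (P := fun w z => w (inl 0) = Nat.pair z (w (inr 0)))
    (ArDef.eq (.var _) (.pair (.var _) (.var _)))) fun w => ?_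
  constructor
  · intro h
    exact ⟨(w (inl 0)).unpair.1, by rw [h, Nat.pair_unpair]⟩
  · rintro ⟨z, hz⟩
    change _ = (w (inl 0)).unpair.2
    rw [hz, Nat.unpair_pair]

theorem ArFun.beta {f g : (α → ℕ) → ℕ} (hf : ArFun Y f) (hg : ArFun Y g) :
    ArFun Y fun v => Nat.beta (f v) (g v) := by
  refine ArFun.comp₂ (h := Nat.beta) ?_ hf hg
  have m : ArFun Y fun w : (Fin 2 ⊕ Fin 1) ⊕ Fin 1 → ℕ =>
      (w (inl (inl 1)) + 1) * (w (inl (inl 0))).unpair.2 + 1 :=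
    (((ArFun.var _).add (.const 1)).mul (ArFun.unpair_snd (.var _))).add (.const 1)
  refine ArDef.of_iff (ArDef.ex (P := fun w q =>
      (w (inl 0)).unpair.1 = w (inr 0) + ((w (inl 1) + 1) * (w (inl 0)).unpair.2 + 1) * q ∧
        w (inr 0) < (w (inl 1) + 1) * (w (inl 0)).unpair.2 + 1)
    ((ArDef.eq (ArFun.unpair_fst (.var _)) ((ArFun.var _).add (m.mul (.var _)))).and
      (ArDef.lt (.var _) m))) fun w => ?_
  change w (inr 0) = Nat.beta (w (inl 0)) (w (inl 1)) ↔ _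
  rw [Nat.beta]
  generalize (w (inl 1) + 1) * (w (inl 0)).unpair.2 = d
  constructor
  · intro h
    refine ⟨(w (inl 0)).unpair.1 / (d + 1), ?_, ?_⟩
    · rw [h, Nat.mod_add_div]
    · rw [h]
      exact Nat.mod_lt _ d.succ_pos
  · rintro ⟨q, hq, hlt⟩
    rw [hq, Nat.add_mul_mod_self_left, Nat.mod_eq_of_lt hlt]

theorem exists_beta_eq (u : ℕ → ℕ) (n : ℕ) : ∃ c, ∀ i ≤ n, Nat.beta c i = u i := by
  refine ⟨Nat.unbeta ((List.range (n + 1)).map u), fun i hi => ?_⟩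
  have := Nat.beta_unbeta_coe ((List.range (n + 1)).map u) ⟨i, by simp; omega⟩
  simpa using this

/-- Primitive recursive functions are arithmetical. -/
theorem ArFun.of_primrec {p : ℕ → ℕ} (hp : Nat.Primrec p) {f : (α → ℕ) → ℕ} (hf : ArFun Y f) :
    ArFun Y fun v => p (f v) := by
  induction hp generalizing α with
  | zero => exact .const 0
  | succ => exact hf.add (.const 1)
  | left => exact hf.unpair_fst
  | right => exact hf.unpair_snd
  | pair _ _ ih₁ ih₂ => exact (ih₁ hf).pair (ih₂ hf)
  | comp _ _ ih₁ ih₂ => exact ih₁ (ih₂ hf)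
  | @prec p q _ _ ihp ihq =>
    refine ArFun.comp₁ (h := Nat.unpaired fun z n =>
      n.rec (p z) fun y IH => q (Nat.pair z (Nat.pair y IH))) ?_ hf
    refine ArDef.of_iff (ArDef.ex (P := fun w c =>
        (Nat.beta c 0 = p (w (inl 0)).unpair.1 ∧
          Nat.beta c (w (inl 0)).unpair.2 = w (inr 0)) ∧
        ∀ i, i < (w (inl 0)).unpair.2 → Nat.beta c (i + 1) =
          q (Nat.pair (w (inl 0)).unpair.1 (Nat.pair i (Nat.beta c i))))
      (ArDef.and (ArDef.and ?_ ?_) (ArDef.all (ArDef.imp ?_ ?_)))) fun w => ?_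
    · exact ArDef.eq (.beta (.var _) (.const 0)) (ihp (.unpair_fst (.var _)))
    · exact ArDef.eq (.beta (.var _) (.unpair_snd (.var _))) (.var _)
    · exact ArDef.lt (.var _) (.unpair_snd (.var _))
    · exact ArDef.eq (.beta (.var _) (.add (.var _) (.const 1)))
        (ihq (.pair (.unpair_fst (.var _)) (.pair (.var _) (.beta (.var _) (.var _)))))
    · change w (inr 0) = Nat.rec (p (w (inl 0)).unpair.1) _ (w (inl 0)).unpair.2 ↔ _
      generalize (w (inl 0)).unpair.1 = z, (w (inl 0)).unpair.2 = n, w (inr 0) = y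
      constructor
      · rintro rfl
        obtain ⟨c, hc⟩ := exists_beta_eq
          (fun n => n.rec (p z) fun y IH => q (Nat.pair z (Nat.pair y IH))) n
        refine ⟨c, ⟨hc 0 n.zero_le, hc n le_rfl⟩, fun i hi => ?_⟩
        rw [hc i hi.le, hc (i + 1) hi]
      · rintro ⟨c, ⟨h0, hn⟩, hs⟩
        have key : ∀ i ≤ n, Nat.beta c i =
            i.rec (p z) fun y IH => q (Nat.pair z (Nat.pair y IH)) := by
          intro i
          induction i with
          | zero => exact fun _ => h0
          | succ i ih => exact fun hi => by rw [hs i hi, ih (Nat.le_of_succ_le hi)]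
        rw [← hn, key n le_rfl]

/-- Membership in a coded list is arithmetical. -/
theorem ArDef.mem_list {f g : (α → ℕ) → ℕ} (hf : ArFun Y f) (hg : ArFun Y g) :
    ArDef Y fun v => f v ∈ Denumerable.ofNat (List ℕ) (g v) := by
  refine ArDef.comp₂ (R := fun e b => e ∈ Denumerable.ofNat (List ℕ) b) ?_ hf hg
  have hp : Nat.Primrec fun n =>
      Encodable.encode ((Denumerable.ofNat (List ℕ) n.unpair.1)[n.unpair.2]?) :=
    Primrec.nat_iff.1 (Primrec.encode.comp (Primrec.list_getElem?.comp
      ((Primrec.ofNat _).comp (Primrec.fst.comp Primrec.unpair))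
      (Primrec.snd.comp Primrec.unpair)))
  refine ArDef.of_iff (ArDef.ex (P := fun v i => Encodable.encode
      ((Denumerable.ofNat (List ℕ) (Nat.pair (v 1) i).unpair.1)[(Nat.pair (v 1) i).unpair.2]?) =
        v 0 + 1)
    (ArDef.eq (.of_primrec hp (.pair (.var _) (.var _))) (.add (.var _) (.const 1)))) fun v => ?_
  rw [List.mem_iff_getElem?]
  refine exists_congr fun i => ?_
  rw [Nat.unpair_pair, ← Encodable.encode_inj, Encodable.encode_some]
  rfl

theorem ArFun.realize (t : arithLang.Term α) {Z : Set ℕ} :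
    letI := arithStructure Z
    ArFun Y fun v => t.realize v := by
  induction t with
  | var i => exact .var i
  | func f ts ih =>
    cases f with
    | zero => exact .const 0
    | one => exact .const 1
    | add => exact (ih 0).add (ih 1)
    | mul => exact (ih 0).mul (ih 1)

theorem ArReducible.mem {X : Set ℕ} (h : ArReducible X Y) {f : (α → ℕ) → ℕ} (hf : ArFun Y f) :
    ArDef Y fun v => f v ∈ X :=
  (arReducible_iff.1 h).comp₁ (R := (· ∈ X)) hf

theorem ArReducible.realize {Z : Set ℕ} (h : ArReducible Y Z) {n : ℕ}
    (φ : arithLang.BoundedFormula α n) :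
    letI := arithStructure Y
    ArDef Z fun w : α ⊕ Fin n → ℕ => φ.Realize (fun i => w (inl i)) fun j => w (inr j) := by
  let := arithStructure Y
  induction φ with
  | falsum => exact .const False
  | equal t s =>
    refine (ArDef.eq (.realize t (Z := Y)) (.realize s (Z := Y))).of_iff fun w => ?_
    have : Sum.elim (fun i => w (inl i)) (fun j => w (inr j)) = w := Sum.elim_comp_inl_inr w
    rw [BoundedFormula.Realize, this]
  | rel R ts =>
    have e : ∀ {m : ℕ} (w : α ⊕ Fin m → ℕ),
        Sum.elim (fun i => w (inl i)) (fun j => w (inr j)) = w :=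
      Sum.elim_comp_inl_inr
    simp only [BoundedFormula.Realize, e]
    cases R with
    | lt => exact ArDef.lt (.realize (ts 0) (Z := Y)) (.realize (ts 1) (Z := Y))
    | mem => exact h.mem (.realize (ts 0) (Z := Y))
  | imp _ _ ih₁ ih₂ => exact ih₁.imp ih₂
  | @all n φ ih =>
    refine ArDef.all (P := fun w y => φ.Realize (fun i => w (inl i))
      (Fin.snoc (fun j => w (inr j)) y)) ?_
    refine (ih.reindex (Sum.elim (fun i => inl (inl i))
      (Fin.snoc (fun j => inl (inr j)) (inr 0) : Fin (n + 1) → (α ⊕ Fin n) ⊕ Fin 1))).of_iff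
      fun w => ?_
    refine iff_of_eq (congrArg _ (funext fun j => ?_))
    refine Fin.lastCases ?_ (fun j => ?_) j <;> simp

theorem ArReducible.trans {X Z : Set ℕ} (hXY : ArReducible X Y) (hYZ : ArReducible Y Z) :
    ArReducible X Z := by
  obtain ⟨φ, rfl⟩ := hXY
  refine arReducible_iff.2 (((hYZ.realize φ).reindex (Sum.elim id Fin.elim0)).of_iff fun v => ?_)
  let := arithStructure Y
  have : v = fun _ => v 0 := funext fun i => congrArg v (Subsingleton.elim _ _)
  change φ.Realize (fun _ => v 0) ↔ BoundedFormula.Realize φ v _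
  rw [← this, Formula.Realize]
  exact iff_of_eq (congrArg _ (Subsingleton.elim _ _))

theorem IsArithmetical.arReducible {X : Set ℕ} (h : IsArithmetical X) : ArReducible X Y :=
  ArReducible.trans h (arReducible_iff.2 (.const False))

end Definability

/-! ## Arithmetical description of the generated substructure -/

section Hull

theorem realize_congr {α M : Type} [L.Structure M] {t : L.Term α} {v w : α → M}
    (h : ∀ i, Sum.inl i ∈ t.listEncode → v i = w i) : t.realize v = t.realize w := by
  induction t with
  | var i => exact h i (by simp [Term.listEncode])
  | func f ts ih =>
    refine congrArg _ (funext fun j => ih j fun i hi => h i ?_)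
    simp only [Term.listEncode, List.mem_cons, List.mem_flatMap]
    exact .inr ⟨j, List.mem_finRange j, hi⟩

theorem mem_range_of_mem_listEncode_relabel {α β : Type} {t : L.Term α} {f : α → β} {b : β}
    (h : Sum.inl b ∈ (t.relabel f).listEncode) : ∃ i, f i = b := by
  induction t with
  | var i =>
    refine ⟨i, ?_⟩
    simpa [Term.listEncode, eq_comm] using h
  | func F ts ih =>
    simp only [Term.relabel, Term.listEncode, List.mem_cons, List.mem_flatMap] at h
    obtain h | ⟨j, -, hj⟩ := h
    · cases h
    · exact ih j hj

theorem pair_eq_zero {m n : ℕ} : Nat.pair m n = 0 ↔ m = 0 ∧ n = 0 :=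
  Nat.pair_eq_pair (c := 0) (d := 0)

theorem listCode_cons (x : ℕ) (l : List ℕ) : listCode (x :: l) = Nat.pair x (listCode l) + 1 :=
  rfl

theorem listCode_injective : Function.Injective listCode :=
  Encodable.encode_injective

theorem ofNat_listCode (l : List ℕ) : Denumerable.ofNat (List ℕ) (listCode l) = l :=
  Denumerable.ofNat_encode l

theorem listCode_ofNat (b : ℕ) : listCode (Denumerable.ofNat (List ℕ) b) = b :=
  Denumerable.encode_ofNat b

/-- The code of the pair consisting of the formula in `k` free variables equating the term coded by
`p` with the variable of index `0`, and the tuple formed by `x` followed by the list coded by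
`b`. -/
def termValueCode (k p x b : ℕ) : ℕ :=
  Nat.pair
    (Nat.pair k (listCode [Nat.pair 0 (Nat.pair 0 p), Nat.pair 0 (Nat.pair 0 (listCode [0]))]))
    (Nat.pair x b + 1)

theorem eq_equal_of_formulaCode {α : Type} {g : GoedelCoding L} {e : α → ℕ} {n p q : ℕ}
    {φ : L.BoundedFormula α n}
    (h : formulaCode g e φ =
      listCode [Nat.pair 0 (Nat.pair 0 p), Nat.pair 0 (Nat.pair 0 q)]) :
    ∃ t s : L.Term (α ⊕ Fin n), φ = .equal t s ∧
      termCode g (Sum.elim (fun a => Nat.pair 0 (e a)) fun i => Nat.pair 1 i.1) t = p ∧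
      termCode g (Sum.elim (fun a => Nat.pair 0 (e a)) fun i => Nat.pair 1 i.1) s = q := by
  have h := listCode_injective h
  cases φ with
  | equal t s =>
    refine ⟨t, s, rfl, ?_⟩
    simp only [BoundedFormula.listEncode, List.map_cons, List.map_nil, Sum.elim_inl,
      List.cons.injEq, Nat.pair_eq_pair, true_and, and_true, and_assoc] at h
    exact ⟨h.2.1, h.2.2.2⟩
  | _ => simp [BoundedFormula.listEncode, Nat.pair_eq_pair] at h

theorem mem_genSub_iff (g : GoedelCoding L) (N : CodedStructure L) {B : Set ↥N.carrier}
    (hB : B.Nonempty) (x : ℕ) :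
    x ∈ subCode (genSub L ↥N.carrier N.struc B) ↔
      ∃ k p b, termValueCode k p x b ∈ elemDiagram g N ∧
        0 ∉ Denumerable.ofNat (List ℕ) p ∧
        ∀ e, e ∈ Denumerable.ofNat (List ℕ) b → e ∈ subCode B := by
  let := N.struc
  constructor
  · rintro ⟨_, ⟨t, v, hv, rfl⟩, rfl⟩
    obtain ⟨m, hm⟩ : ∃ m, ∀ i, Sum.inl i ∈ t.listEncode → i ≤ m := by
      obtain ⟨m, hm⟩ := (((t.listEncode.finite_toSet).preimage
        (Sum.inl_injective.injOn)).bddAbove : BddAbove (Sum.inl ⁻¹' {x | x ∈ t.listEncode}))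
      exact ⟨m, fun i hi => hm hi⟩
    let f : ℕ → Fin (m + 2) ⊕ Fin 0 := fun i => .inl ⟨min i m + 1, by omega⟩
    let w : Fin (m + 2) → ↥N.carrier := Fin.cons (t.realize v) fun j : Fin (m + 1) => v j
    refine ⟨m + 2, termCode g (Sum.elim (fun a => Nat.pair 0 a.val) fun i => Nat.pair 1 i.1)
      (t.relabel f), listCode (List.ofFn fun j : Fin (m + 1) => (v j : ℕ)),
      ⟨m + 2, .equal (t.relabel f) (.var (.inl 0)), w, ?_, ?_⟩, ?_, ?_⟩
    · simp [termValueCode, tupleCode, List.ofFn_succ, listCode_cons, w, formulaCode,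
        BoundedFormula.listEncode, termCode, Term.listEncode]
      exact (pair_eq_zero.2 ⟨rfl, pair_eq_zero.2 ⟨rfl, rfl⟩⟩).symm
    · change (t.relabel f).realize _ = w 0
      rw [Term.realize_relabel]
      refine realize_congr fun i hi => ?_
      have := hm i hi
      change w ⟨min i m + 1, by omega⟩ = v i
      rw [show v i = v (⟨i, by omega⟩ : Fin (m + 1)) from rfl]
      simp [w, Fin.cons, this]
    · rw [termCode, ofNat_listCode, List.mem_map]
      rintro ⟨s, hs, h0⟩
      rcases s with s | s
      · obtain ⟨i, rfl⟩ := mem_range_of_mem_listEncode_relabel hs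
        simp [f, pair_eq_zero] at h0
      · simp [pair_eq_zero] at h0
    · intro e he
      rw [ofNat_listCode, List.mem_ofFn] at he
      obtain ⟨j, rfl⟩ := he
      exact ⟨v j, hv j, rfl⟩
  · rintro ⟨k, p, b, ⟨k, φ, w, hc, hφ⟩, hp, hb⟩
    obtain ⟨hc, hw⟩ := Nat.pair_eq_pair.1 hc
    obtain ⟨rfl, hc⟩ := Nat.pair_eq_pair.1 hc
    obtain ⟨t, s, rfl, rfl, hs⟩ := eq_equal_of_formulaCode hc.symm
    obtain ⟨i, rfl, hi⟩ : ∃ i : Fin k, s = .var (.inl i) ∧ i.val = 0 := by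
      have hs := listCode_injective hs
      cases s with
      | var i =>
        rcases i with i | i
        · exact ⟨i, rfl, by simpa [Term.listEncode, pair_eq_zero] using hs⟩
        · exact i.elim0
      | func => simp [Term.listEncode, pair_eq_zero] at hs
    obtain ⟨b, rfl⟩ : ∃ l, listCode l = b := ⟨_, listCode_ofNat b⟩
    rw [ofNat_listCode] at hb
    rw [termCode, ofNat_listCode] at hp
    have hw : x :: b = List.ofFn fun j => (w j : ℕ) := listCode_injective hw
    obtain ⟨k, rfl⟩ : ∃ m, k = m + 1 := ⟨k - 1, by have := i.2; omega⟩
    obtain rfl : i = 0 := Fin.ext hi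
    rw [List.ofFn_succ, List.cons.injEq] at hw
    have hwB : ∀ j : Fin k, w j.succ ∈ B := fun j => by
      obtain ⟨y, hy, hyw⟩ := hb (w j.succ) (hw.2 ▸ List.mem_ofFn.2 ⟨j, rfl⟩)
      rwa [← Subtype.ext hyw]
    obtain ⟨z, hz⟩ := hB
    refine ⟨w 0, ⟨t.relabel (Sum.elim Fin.val Fin.elim0),
      fun n => if h : n - 1 < k then w (Fin.succ ⟨n - 1, h⟩) else z, fun n => ?_, ?_⟩, hw.1.symm⟩
    · dsimp only
      split_ifs with h
      exacts [hwB _, hz]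
    · have hφ : t.realize (Sum.elim w _) = w 0 := hφ
      rw [← hφ, Term.realize_relabel]
      refine realize_congr fun s hs => ?_
      rcases s with j | j
      · induction j using Fin.cases with
        | zero => exact (hp (List.mem_map.2 ⟨_, hs, by simp [pair_eq_zero]⟩)).elim
        | succ j =>
          simp
          rfl
      · exact j.elim0

theorem genSub_mono {M : Type} (SM : L.Structure M) {B C : Set M} (h : B ⊆ C) :
    genSub L M SM B ⊆ genSub L M SM C :=
  fun _ ⟨t, v, hv, hx⟩ => ⟨t, v, fun i => h (hv i), hx⟩

theorem subset_genSub {M : Type} (SM : L.Structure M) (B : Set M) : B ⊆ genSub L M SM B :=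
  fun x hx => ⟨.var 0, fun _ => x, fun _ => hx, rfl⟩

theorem genSub_empty {M : Type} (SM : L.Structure M) : genSub L M SM ∅ = ∅ :=
  Set.eq_empty_iff_forall_notMem.2 fun _ ⟨_, _, hv, _⟩ => hv 0

/-- In an arithmetically decidable structure, the substructure generated by a set is arithmetical
in that set. -/
theorem arReducible_genSub {g : GoedelCoding L} {N : CodedStructure L} (hN : ArithDecidable g N)
    {B : Set ↥N.carrier} {Y : Set ℕ} (hB : ArReducible (subCode B) Y) :
    ArReducible (subCode (genSub L ↥N.carrier N.struc B)) Y := by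
  rcases B.eq_empty_or_nonempty with rfl | hne
  · rw [genSub_empty]
    exact hB
  · refine arReducible_iff.2 (ArDef.of_iff (ArDef.ex (ArDef.ex (ArDef.ex (ArDef.and ?_ (ArDef.and
      ?_ (ArDef.all (ArDef.imp ?_ ?_))))))) fun v => mem_genSub_iff g N hne (v 0))
    · refine hN.arReducible.mem ?_
      simp only [termValueCode, listCode_cons]
      exact .pair (.pair (.var _) (.add (.pair (.pair (.const _) (.pair (.const _) (.var _)))
        (.const _)) (.const _))) (.add (.pair (.var _) (.var _)) (.const _))
    · exact (ArDef.mem_list (.const _) (.var _)).not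
    · exact ArDef.mem_list (.var _) (.var _)
    · exact hB.mem (.var _)

end Hull

/-- **Degree of a Skolem hull over a named base.** -/
theorem skolem_hull_degree_over_base
    (L : FirstOrder.Language) (g : GoedelCoding L)
    (N : CodedStructure L) (hN : ArithDecidable g N)
    (A : Set ℕ) (hA : A ⊆ N.carrier) (hAar : IsArithmetical A)
    (a : ℕ → ↥N.carrier)
    (hgraph : IsArithmetical { c : ℕ | ∃ n : ℕ, c = Nat.pair n ((a n : ℕ)) })
    (hind : ∀ n : ℕ, a n ∉ genSub L ↥N.carrier N.struc
      ({ x : ↥N.carrier | (x : ℕ) ∈ A } ∪ { x | ∃ i : ℕ, i ≠ n ∧ a i = x }))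
    (S : Set ℕ) :
    ArReducible (subCode (hullS L N A a S)) S ∧
    (∀ n : ℕ, a n ∈ hullS L N A a S ↔ n ∈ S) ∧
    (¬ IsArithmetical S → ArEquiv (subCode (hullS L N A a S)) S) := by
  have hSS : ArReducible S S := arReducible_iff.2 (.oracle (.var 0))
  have hB : ArReducible (subCode ({ x : ↥N.carrier | (x : ℕ) ∈ A } ∪ { x | ∃ n ∈ S, a n = x }))
      S := by
    refine arReducible_iff.2 (((hAar.arReducible.mem (.var 0)).or (ArDef.ex
      (P := fun v n => n ∈ S ∧ Nat.pair n (v 0) ∈ { c : ℕ | ∃ n : ℕ, c = Nat.pair n ((a n : ℕ)) })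
      ((hSS.mem (.var _)).and (hgraph.arReducible.mem (.pair (.var _) (.var _)))))).of_iff
      fun v => ?_)
    constructor
    · rintro ⟨x, hx | ⟨n, hn, rfl⟩, hxv⟩
      · exact .inl (hxv ▸ hx)
      · exact .inr ⟨n, hn, n, by rw [hxv]⟩
    · rintro (h | ⟨n, hn, m, hm⟩)
      · exact ⟨⟨v 0, hA h⟩, .inl h, rfl⟩
      · obtain ⟨rfl, hm⟩ := Nat.pair_eq_pair.1 hm
        exact ⟨a n, .inr ⟨n, hn, rfl⟩, hm.symm⟩
  have hle : ArReducible (subCode (hullS L N A a S)) S := arReducible_genSub hN hB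
  have hmem : ∀ n : ℕ, a n ∈ hullS L N A a S ↔ n ∈ S := by
    refine fun n => ⟨fun h => ?_, fun h => subset_genSub _ _ (.inr ⟨n, h, rfl⟩)⟩
    by_contra hn
    refine hind n (genSub_mono _ (Set.union_subset_union_right _ ?_) h)
    rintro x ⟨i, hi, rfl⟩
    exact ⟨i, fun hin => hn (hin ▸ hi), rfl⟩
  refine ⟨hle, hmem, fun _ => ⟨hle, arReducible_iff.2 ?_⟩⟩
  have hHH : ArReducible (subCode (hullS L N A a S)) (subCode (hullS L N A a S)) :=
    arReducible_iff.2 (.oracle (.var 0))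
  refine (ArDef.ex (P := fun v m =>
    Nat.pair (v 0) m ∈ { c : ℕ | ∃ n : ℕ, c = Nat.pair n ((a n : ℕ)) } ∧
      m ∈ subCode (hullS L N A a S))
    ((hgraph.arReducible.mem (.pair (.var _) (.var _))).and (hHH.mem (.var _)))).of_iff fun v => ?_
  rw [← hmem (v 0)]
  constructor
  · exact fun h => ⟨a (v 0), ⟨v 0, rfl⟩, a (v 0), h, rfl⟩
  · rintro ⟨m, ⟨n, hn⟩, y, hy, rfl⟩
    obtain ⟨hn, hyn⟩ := Nat.pair_eq_pair.1 hn
    rwa [hn, ← Subtype.ext hyn]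

end ArMorley
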